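/- Let h be a concave distortion function and let c:ℝ²→ℝ be a supermodular cost function that is monotone (either increasing in each argument or decreasing in each argument). If X and Y are bounded counter-monotonic random variables, then for all bounded random variables X', Y' with X' equal in distribution to X and Y' equal in distribution to Y, one has E^h[c(X,Y)] ≤ E^h[c(X',Y')]. (That is, the counter-monotonic coupling is universally optimal for (c,h).) -/

import Mathlib

open MeasureTheory Set ProbabilityTheory

noncomputable section

variable {Ω : Type*} [MeasurableSpace Ω]

/-- An atomless probability measure: every non-null measurable set has a measurable
subset of strictly smaller positive measure. -/
def AtomlessProb (P : Measure Ω) : Prop :=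
  ∀ A : Set Ω, MeasurableSet A → 0 < P A →
    ∃ B ⊆ A, MeasurableSet B ∧ 0 < P B ∧ P B < P A

/-- A distortion function: increasing on `[0,1]` with `h 0 = 0` and `h 1 = 1`. -/
def IsDistortion (h : ℝ → ℝ) : Prop :=
  MonotoneOn h (Icc 0 1) ∧ h 0 = 0 ∧ h 1 = 1

/-- The distorted expectation `E^h[Z]`. -/
def distExp (P : Measure Ω) (h : ℝ → ℝ) (Z : Ω → ℝ) : ℝ :=
  (∫ x in Ioi (0:ℝ), h (P {ω | Z ω > x}).toReal) +
  (∫ x in Iio (0:ℝ), (h (P {ω | Z ω > x}).toReal - 1))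

/-- Bounded measurable real random variable. -/
def IsBddRV (X : Ω → ℝ) : Prop :=
  Measurable X ∧ ∃ M : ℝ, ∀ ω, |X ω| ≤ M

/-- X and Y are comonotonic. -/
def Comonotone (P : Measure Ω) (X Y : Ω → ℝ) : Prop :=
  ∃ f g : ℝ → ℝ, Monotone f ∧ Monotone g ∧
    ∀ᵐ ω ∂P, X ω = f (X ω + Y ω) ∧ Y ω = g (X ω + Y ω)

/-- X and Y are counter-monotonic: X and -Y are comonotonic. -/
def CounterMonotone (P : Measure Ω) (X Y : Ω → ℝ) : Prop :=
  Comonotone P X (fun ω => -Y ω)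

def Submodular (c : ℝ → ℝ → ℝ) : Prop :=
  ∀ x₁ y₁ x₂ y₂ : ℝ,
    c (min x₁ x₂) (min y₁ y₂) + c (max x₁ x₂) (max y₁ y₂) ≤ c x₁ y₁ + c x₂ y₂

def Supermodular (c : ℝ → ℝ → ℝ) : Prop :=
  ∀ x₁ y₁ x₂ y₂ : ℝ,
    c x₁ y₁ + c x₂ y₂ ≤ c (min x₁ x₂) (min y₁ y₂) + c (max x₁ x₂) (max y₁ y₂)

/-- c is monotone: increasing in each argument or decreasing in each argument. -/
def MonotoneCost (c : ℝ → ℝ → ℝ) : Prop :=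
  Monotone (fun q : ℝ × ℝ => c q.1 q.2) ∨ Antitone (fun q : ℝ × ℝ => c q.1 q.2)

/-- A 2-copula. -/
def IsCopula (C : ℝ → ℝ → ℝ) : Prop :=
  (∀ u ∈ Icc (0:ℝ) 1, C u 0 = 0 ∧ C 0 u = 0 ∧ C u 1 = u ∧ C 1 u = u) ∧
  (∀ u₁ u₂ v₁ v₂ : ℝ, u₁ ∈ Icc (0:ℝ) 1 → u₂ ∈ Icc (0:ℝ) 1 →
    v₁ ∈ Icc (0:ℝ) 1 → v₂ ∈ Icc (0:ℝ) 1 → u₁ ≤ u₂ → v₁ ≤ v₂ →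
    0 ≤ C u₂ v₂ - C u₂ v₁ - C u₁ v₂ + C u₁ v₁)

/-- (X, Y) has copula C. -/
def HasCopula (P : Measure Ω) (X Y : Ω → ℝ) (C : ℝ → ℝ → ℝ) : Prop :=
  ∀ x y : ℝ, (P {ω | X ω ≤ x ∧ Y ω ≤ y}).toReal =
    C (P {ω | X ω ≤ x}).toReal (P {ω | Y ω ≤ y}).toReal

/-- C is universally optimal for h with linear cost. -/
def UnivOptimal (P : Measure Ω) (h : ℝ → ℝ) (C : ℝ → ℝ → ℝ) : Prop :=
  ∀ X Y X' Y' : Ω → ℝ, IsBddRV X → IsBddRV Y → IsBddRV X' → IsBddRV Y' →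
    HasCopula P X Y C → IdentDistrib X X' P P → IdentDistrib Y Y' P P →
    distExp P h (fun ω => X ω + Y ω) ≤ distExp P h (fun ω => X' ω + Y' ω)

/-- C is universally maximal for h with linear cost. -/
def UnivMaximal (P : Measure Ω) (h : ℝ → ℝ) (C : ℝ → ℝ → ℝ) : Prop :=
  ∀ X Y X' Y' : Ω → ℝ, IsBddRV X → IsBddRV Y → IsBddRV X' → IsBddRV Y' →
    HasCopula P X Y C → IdentDistrib X X' P P → IdentDistrib Y Y' P P →
    distExp P h (fun ω => X' ω + Y' ω) ≤ distExp P h (fun ω => X ω + Y ω)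

/-- C is universally optimal within a class 𝒞 of copulas for h with linear cost. -/
def UnivOptimalWithin (P : Measure Ω) (h : ℝ → ℝ) (C : ℝ → ℝ → ℝ)
    (𝒞 : Set (ℝ → ℝ → ℝ)) : Prop :=
  ∀ X Y X' Y' : Ω → ℝ, IsBddRV X → IsBddRV Y → IsBddRV X' → IsBddRV Y' →
    HasCopula P X Y C → (∃ C' ∈ 𝒞, HasCopula P X' Y' C') →
    IdentDistrib X X' P P → IdentDistrib Y Y' P P →
    distExp P h (fun ω => X ω + Y ω) ≤ distExp P h (fun ω => X' ω + Y' ω)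

/-- C is universally maximal within a class 𝒞 of copulas for h with linear cost. -/
def UnivMaximalWithin (P : Measure Ω) (h : ℝ → ℝ) (C : ℝ → ℝ → ℝ)
    (𝒞 : Set (ℝ → ℝ → ℝ)) : Prop :=
  ∀ X Y X' Y' : Ω → ℝ, IsBddRV X → IsBddRV Y → IsBddRV X' → IsBddRV Y' →
    HasCopula P X Y C → (∃ C' ∈ 𝒞, HasCopula P X' Y' C') →
    IdentDistrib X X' P P → IdentDistrib Y Y' P P →
    distExp P h (fun ω => X' ω + Y' ω) ≤ distExp P h (fun ω => X ω + Y ω)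

/-- The set 𝒞_p of copulas C with C(1-p,1-p) = 1-p. -/
def copulaSet (p : ℝ) : Set (ℝ → ℝ → ℝ) :=
  {C | IsCopula C ∧ C (1 - p) (1 - p) = 1 - p}

/-- The "first comonotonic, then counter-monotonic" copula C^±_p. -/
def Cpm (p : ℝ) (u v : ℝ) : ℝ :=
  if min u v ≤ 1 - p then min u v else max (u + v - 1) (1 - p)

/-- The "first counter-monotonic, then comonotonic" copula C^∓_p. -/
def Cmp (p : ℝ) (u v : ℝ) : ℝ :=
  if max u v ≤ 1 - p then max (u + v - 1 + p) 0 else min u v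

/-- Inverse S-shaped distortion with inflection point p: continuous, concave on (0,p),
convex on (p,1). -/
def IsISS (h : ℝ → ℝ) (p : ℝ) : Prop :=
  ContinuousOn h (Icc 0 1) ∧ ConcaveOn ℝ (Ioo 0 p) h ∧ ConvexOn ℝ (Ioo p 1) h

/-- Strictly inverse S-shaped distortion with inflection point p. -/
def IsStrictISS (h : ℝ → ℝ) (p : ℝ) : Prop :=
  ContinuousOn h (Icc 0 1) ∧ StrictConcaveOn ℝ (Ioo 0 p) h ∧ StrictConvexOn ℝ (Ioo p 1) h

/-- S-shaped distortion with inflection point p: continuous, convex on (0,p),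
concave on (p,1). -/
def IsSS (h : ℝ → ℝ) (p : ℝ) : Prop :=
  ContinuousOn h (Icc 0 1) ∧ ConvexOn ℝ (Ioo 0 p) h ∧ ConcaveOn ℝ (Ioo p 1) h

/-- Strictly S-shaped distortion with inflection point p. -/
def IsStrictSS (h : ℝ → ℝ) (p : ℝ) : Prop :=
  ContinuousOn h (Icc 0 1) ∧ StrictConvexOn ℝ (Ioo 0 p) h ∧ StrictConcaveOn ℝ (Ioo p 1) h

/-- Left quantile of Z at level t. -/
def leftQuantile (P : Measure Ω) (Z : Ω → ℝ) (t : ℝ) : ℝ :=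
  sInf {x : ℝ | t ≤ (P {ω | Z ω ≤ x}).toReal}

/-- W is (a version of) the upper p-tail transform Z^∨_p of Z: its left-quantile
function is t ↦ Q_{(1-p)+pt}(Z). -/
def IsUpperTail (P : Measure Ω) (p : ℝ) (Z W : Ω → ℝ) : Prop :=
  ∀ t ∈ Ioc (0:ℝ) 1, leftQuantile P W t = leftQuantile P Z ((1 - p) + p * t)

/-- W is (a version of) the lower tail transform Z^∧_p of Z: its left-quantile
function is t ↦ Q_{(1-p)t}(Z). -/
def IsLowerTail (P : Measure Ω) (p : ℝ) (Z W : Ω → ℝ) : Prop :=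
  ∀ t ∈ Ioc (0:ℝ) 1, leftQuantile P W t = leftQuantile P Z ((1 - p) * t)

/-- Expected Shortfall at level p. -/
def ES (P : Measure Ω) (p : ℝ) (Z : Ω → ℝ) : ℝ :=
  (1 / (1 - p)) * ∫ r in p..1, leftQuantile P Z r

section Potential

variable {ι : Type*} [LinearOrder ι]

theorem exists_potential_finset {k : ι → ι → ℝ} (hdiag : ∀ t, k t t = 0)
    (hmax : ∀ s t w, s ≤ w → t ≤ w → k t s ≤ k t w + k w s) (F : Finset ι) :
    ∃ U : ι → ℝ, ∀ s ∈ F, ∀ t ∈ F, U s ≤ U t + k t s := by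
  induction F using Finset.induction_on_max with
  | empty => exact ⟨0, by simp⟩
  | insert w F hw ih =>
    obtain ⟨U, hU⟩ := ih
    rcases F.eq_empty_or_nonempty with rfl | hF
    · exact ⟨0, by simp [hdiag]⟩
    set m := F.inf' hF fun t => U t + k t w with hm
    have hmle : ∀ t ∈ F, m ≤ U t + k t w := fun t ht => Finset.inf'_le _ ht
    obtain ⟨t₁, ht₁, hmt⟩ := F.exists_mem_eq_inf' hF fun t => U t + k t w
    have hne : ∀ t ∈ F, t ≠ w := fun t ht => (hw t ht).ne
    refine ⟨Function.update U w m, fun s hs t ht => ?_⟩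
    rw [Finset.mem_insert] at hs ht
    rcases hs with rfl | hs <;> rcases ht with rfl | ht
    · simp [hdiag]
    · simpa [hne t ht] using hmle t ht
    · simp only [Function.update_self, Function.update_of_ne (hne s hs)]
      have h1 := hU s hs t₁ ht₁
      have h2 := hmax s t₁ t (hw s hs).le (hw t₁ ht₁).le
      linarith
    · simpa [hne t ht, hne s hs] using hU s hs t ht

theorem exists_potential [Nonempty ι] {k : ι → ι → ℝ} {B : ℝ} (hdiag : ∀ t, k t t = 0)
    (hmax : ∀ s t w, s ≤ w → t ≤ w → k t s ≤ k t w + k w s) (hB : ∀ s t, |k s t| ≤ B) :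
    ∃ U : ι → ℝ, (∀ s t, U s ≤ U t + k t s) ∧ ∀ t, |U t| ≤ B := by
  obtain ⟨t₀⟩ := ‹Nonempty ι›
  have hB0 : 0 ≤ B := (abs_nonneg _).trans (hB t₀ t₀)
  have hcomp : IsCompact (univ.pi fun _ : ι => Icc (-B) B) :=
    isCompact_univ_pi fun _ => isCompact_Icc
  obtain ⟨U, hUB, hU⟩ := hcomp.inter_iInter_nonempty
    (fun p : ι × ι => {U : ι → ℝ | U p.1 ≤ U p.2 + k p.2 p.1})
    (fun p => isClosed_le (by fun_prop) (by fun_prop)) (fun G => by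
      set F : Finset ι := insert t₀ (G.image Prod.fst ∪ G.image Prod.snd) with hF
      obtain ⟨U, hU⟩ := exists_potential_finset hdiag hmax F
      have ht₀ : t₀ ∈ F := by simp [hF]
      refine ⟨fun t => if t ∈ F then U t - U t₀ else 0, ?_, ?_⟩
      · intro t _
        by_cases ht : t ∈ F
        · have h1 := hU t ht t₀ ht₀
          have h2 := hU t₀ ht₀ t ht
          have h3 := abs_le.1 (hB t₀ t)
          have h4 := abs_le.1 (hB t t₀)
          simp only [ht, if_true, mem_Icc]
          constructor <;> linarith
        · simp [ht, hB0]
      · simp only [mem_iInter, mem_ofPred_eq]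
        intro p hp
        have h1 : p.1 ∈ F := by
          simp only [hF, Finset.mem_insert, Finset.mem_union]
          exact Or.inr (Or.inl (Finset.mem_image_of_mem _ hp))
        have h2 : p.2 ∈ F := by
          simp only [hF, Finset.mem_insert, Finset.mem_union]
          exact Or.inr (Or.inr (Finset.mem_image_of_mem _ hp))
        have := hU _ h1 _ h2
        simp only [h1, h2, if_true]
        linarith)
  refine ⟨U, fun s t => ?_, fun t => abs_le.2 (hUB t (mem_univ t))⟩
  exact mem_iInter.1 hU (s, t)

end Potential

section Supermodular

variable {c : ℝ → ℝ → ℝ}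

theorem Supermodular.add_le_add (hc : Supermodular c) {x₁ x₂ y₁ y₂ : ℝ} (hx : x₁ ≤ x₂)
    (hy : y₁ ≤ y₂) : c x₁ y₂ + c x₂ y₁ ≤ c x₁ y₁ + c x₂ y₂ := by
  simpa [hx, hy] using hc x₁ y₂ x₂ y₁

theorem Supermodular.comp_monotone (hc : Supermodular c) {a : ℝ → ℝ} (ha : Monotone a) :
    Supermodular fun x y => c (a x) (a y) := fun x₁ y₁ x₂ y₂ => by
  simpa only [ha.map_min, ha.map_max] using hc (a x₁) (a y₁) (a x₂) (a y₂)

theorem Supermodular.comp_antitone (hc : Supermodular c) {a : ℝ → ℝ} (ha : Antitone a) :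
    Supermodular fun x y => c (a x) (a y) := fun x₁ y₁ x₂ y₂ => by
  simpa only [ha.map_min, ha.map_max, add_comm] using hc (a x₁) (a y₁) (a x₂) (a y₂)

theorem Supermodular.posPart_sub (hc : Supermodular c)
    (hmono : Monotone fun q : ℝ × ℝ => c q.1 q.2) (k : ℝ) :
    Supermodular fun x y => max (c x y - k) 0 := fun x₁ y₁ x₂ y₂ => by
  have h0 := hc x₁ y₁ x₂ y₂
  have h1 : c (min x₁ x₂) (min y₁ y₂) ≤ c x₁ y₁ :=
    hmono (Prod.mk_le_mk.2 ⟨min_le_left _ _, min_le_left _ _⟩)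
  have h2 : c (min x₁ x₂) (min y₁ y₂) ≤ c x₂ y₂ :=
    hmono (Prod.mk_le_mk.2 ⟨min_le_right _ _, min_le_right _ _⟩)
  have h3 : c x₁ y₁ ≤ c (max x₁ x₂) (max y₁ y₂) :=
    hmono (Prod.mk_le_mk.2 ⟨le_max_left _ _, le_max_left _ _⟩)
  have h4 : c x₂ y₂ ≤ c (max x₁ x₂) (max y₁ y₂) :=
    hmono (Prod.mk_le_mk.2 ⟨le_max_right _ _, le_max_right _ _⟩)
  dsimp only
  generalize c (min x₁ x₂) (min y₁ y₂) = a at *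
  generalize c (max x₁ x₂) (max y₁ y₂) = b at *
  rcases max_cases (a - k) 0 with h | h <;> rcases max_cases (b - k) 0 with h' | h' <;>
  rcases max_cases (c x₁ y₁ - k) 0 with g | g <;>
  rcases max_cases (c x₂ y₂ - k) 0 with g' | g' <;> linarith

/-- Kantorovich potentials of a counter-monotone curve for a supermodular cost. -/
theorem Supermodular.exists_dual_potentials {φ : ℝ → ℝ → ℝ} (hφ : Supermodular φ)
    (hmono : Monotone fun q : ℝ × ℝ => φ q.1 q.2) {K : ℝ} (hK : ∀ x y, |φ x y| ≤ K)
    {f r : ℝ → ℝ} (hf : Monotone f) (hr : Antitone r) :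
    ∃ u v : ℝ → ℝ, Monotone u ∧ Monotone v ∧ (∃ B, ∀ x, |u x| ≤ B) ∧ (∃ B, ∀ x, |v x| ≤ B) ∧
      (∀ x y, u x + v y ≤ φ x y) ∧ ∀ t, u (f t) + v (r t) = φ (f t) (r t) := by
  have hK' := fun x y => abs_le.1 (hK x y)
  obtain ⟨U, hU, hUB⟩ := exists_potential (ι := ℝ)
    (k := fun t s => φ (f s) (r t) - φ (f t) (r t)) (B := 2 * K) (by simp)
    (fun s t w hs ht => by
      have := hφ.add_le_add (hf hs) (hr ht)
      linarith)
    (fun s t => abs_le.2 (by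
      have := hK' (f t) (r s); have := hK' (f s) (r s)
      constructor <;> linarith))
  have hUB' := fun t => abs_le.1 (hUB t)
  let u : ℝ → ℝ := fun x => ⨅ t, (φ x (r t) - φ (f t) (r t) + U t)
  have hubdd : ∀ x, BddBelow (range fun t => φ x (r t) - φ (f t) (r t) + U t) := fun x =>
    ⟨-4 * K, by
      rintro _ ⟨t, rfl⟩
      have := hK' x (r t); have := hK' (f t) (r t); have := hUB' t
      dsimp only
      linarith⟩
  have hule : ∀ x t, u x ≤ φ x (r t) - φ (f t) (r t) + U t := fun x t => ciInf_le (hubdd x) t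
  have hu1 : ∀ x, -4 * K ≤ u x := fun x => le_ciInf fun t => by
    have := hK' x (r t); have := hK' (f t) (r t); have := hUB' t
    linarith
  have hu2 : ∀ x, u x ≤ 4 * K := fun x => (hule x 0).trans (by
    have := hK' x (r 0); have := hK' (f 0) (r 0); have := hUB' 0
    linarith)
  let v : ℝ → ℝ := fun y => ⨅ x, (φ x y - u x)
  have hvbdd : ∀ y, BddBelow (range fun x => φ x y - u x) := fun y =>
    ⟨-5 * K, by
      rintro _ ⟨x, rfl⟩
      have := hK' x y; have := hu2 x
      dsimp only
      linarith⟩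
  have hvle : ∀ x y, v y ≤ φ x y - u x := fun x y => ciInf_le (hvbdd y) x
  have hfu : ∀ t, U t ≤ u (f t) := fun t => le_ciInf fun s => by
    have := hU t s
    linarith
  have hrv : ∀ t, φ (f t) (r t) - U t ≤ v (r t) := fun t => le_ciInf fun x => by
    have := hule x t
    linarith
  refine ⟨u, v, ?_, ?_, ⟨4 * K, fun x => abs_le.2 ⟨by linarith [hu1 x], hu2 x⟩⟩,
    ⟨5 * K, fun y => abs_le.2 ⟨?_, ?_⟩⟩, ?_, ?_⟩
  · intro x x' hx
    refine ciInf_mono (hubdd x) fun t => ?_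
    have : φ x (r t) ≤ φ x' (r t) := hmono (Prod.mk_le_mk.2 ⟨hx, le_rfl⟩)
    linarith
  · intro y y' hy
    refine ciInf_mono (hvbdd y) fun x => ?_
    have : φ x y ≤ φ x y' := hmono (Prod.mk_le_mk.2 ⟨le_rfl, hy⟩)
    linarith
  · refine le_ciInf fun x => ?_
    have := hK' x y; have := hu2 x
    linarith
  · have := hvle 0 y; have := hK' 0 y; have := hu1 0
    linarith
  · intro x y
    have := hvle x y
    linarith
  · intro t
    refine le_antisymm ?_ ?_
    · have := hvle (f t) (r t)
      linarith
    · have := hfu t; have := hrv t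
      linarith

end Supermodular

theorem integrableOn_Ioi_of_antitone {S : ℝ → ℝ} (hS : Antitone S) {K : ℝ}
    (hK : ∀ x, K ≤ x → S x = 0) (k : ℝ) : IntegrableOn S (Ioi k) := by
  have h1 : IntegrableOn S (Icc k (max k K)) := (hS.antitoneOn _).integrableOn_isCompact isCompact_Icc
  have h2 : IntegrableOn S (Ici (max k K)) :=
    integrableOn_zero.congr_fun (fun x hx => (hK x ((le_max_right _ _).trans hx)).symm)
      measurableSet_Ici
  refine (h1.union h2).mono_set fun x hx => ?_
  rcases le_total x (max k K) with h | h
  · exact Or.inl ⟨(mem_Ioi.1 hx).le, h⟩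
  · exact Or.inr h

/-- Survival functions are antitone, even for functions that are not measurable. -/
theorem antitone_measure_gt (P : Measure Ω) [IsFiniteMeasure P] (Z : Ω → ℝ) :
    Antitone fun x => (P {ω | Z ω > x}).toReal := fun _ _ hxy =>
  ENNReal.toReal_mono (measure_ne_top _ _) (measure_mono fun _ hω => lt_of_le_of_lt hxy hω)

theorem setIntegral_Ioi_comp_add (S : ℝ → ℝ) (k : ℝ) :
    ∫ x in Ioi k, S x = ∫ s in Ioi (0 : ℝ), S (s + k) := by
  have := (measurePreserving_add_right volume k).setIntegral_preimage_emb
    (measurableEmbedding_addRight k) S (Ioi k)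
  simpa using this.symm

theorem stopLoss_le_of_counterMonotone (P : Measure Ω) [IsProbabilityMeasure P]
    {c : ℝ → ℝ → ℝ} (hsup : Supermodular c) (hmono : Monotone fun q : ℝ × ℝ => c q.1 q.2)
    {K : ℝ} (hK : ∀ x y, |c x y| ≤ K) {X Y X' Y' : Ω → ℝ}
    (hctm : CounterMonotone P X Y)
    (hXX' : IdentDistrib X X' P P) (hYY' : IdentDistrib Y Y' P P) (k : ℝ) :
    ∫ x in Ioi k, (P {ω | c (X ω) (Y ω) > x}).toReal ≤
      ∫ x in Ioi k, (P {ω | c (X' ω) (Y' ω) > x}).toReal := by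
  obtain ⟨f, g, hf, hg, hfg⟩ := hctm
  have hφmono : Monotone fun q : ℝ × ℝ => max (c q.1 q.2 - k) 0 := fun p q hpq =>
    max_le_max (sub_le_sub_right (hmono hpq) k) le_rfl
  obtain ⟨u, v, hu, hv, ⟨Bu, hBu⟩, ⟨Bv, hBv⟩, hle, heq⟩ :=
    (hsup.posPart_sub hmono k).exists_dual_potentials hφmono (K := K + |k|)
      (fun x y => by
        have h1 := abs_le.1 (hK x y)
        have h2 := neg_abs_le k
        have h3 := abs_nonneg k
        rw [abs_of_nonneg (le_max_right _ _)]
        exact max_le (by linarith) (by linarith)) hf (r := fun t => -g t) hg.neg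
  have hint : ∀ {w : ℝ → ℝ} {B : ℝ} {Z : Ω → ℝ}, Monotone w → (∀ x, |w x| ≤ B) →
      AEMeasurable Z P → Integrable (fun ω => w (Z ω)) P := fun hw hB hZ =>
    Integrable.of_bound (hw.measurable.comp_aemeasurable hZ).aestronglyMeasurable _
      (ae_of_all _ fun ω => hB _)
  have iuX := hint hu hBu hXX'.aemeasurable_fst
  have iuX' := hint hu hBu hXX'.aemeasurable_snd
  have ivY := hint hv hBv hYY'.aemeasurable_fst
  have ivY' := hint hv hBv hYY'.aemeasurable_snd
  have hW : ∀ᵐ ω ∂P, u (X ω) + v (Y ω) = max (c (X ω) (Y ω) - k) 0 := by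
    filter_upwards [hfg] with ω hω
    have := heq (X ω + -Y ω)
    rwa [← hω.1, show -g (X ω + -Y ω) = Y ω from neg_eq_iff_eq_neg.2 hω.2.symm] at this
  have hev : ∫ ω, (u (X ω) + v (Y ω)) ∂P = ∫ ω, (u (X' ω) + v (Y' ω)) ∂P := by
    rw [integral_add iuX ivY, integral_add iuX' ivY']
    congr 1
    · exact (hXX'.comp hu.measurable).integral_eq
    · exact (hYY'.comp hv.measurable).integral_eq
  have hposiff : ∀ {z s : ℝ}, 0 < s → (s < max (z - k) 0 ↔ z > s + k) := fun hs => by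
    rw [lt_max_iff]
    constructor
    · rintro (h | h) <;> linarith
    · intro h; left; linarith
  have hleft : ∫ x in Ioi k, (P {ω | c (X ω) (Y ω) > x}).toReal =
      ∫ ω, (u (X ω) + v (Y ω)) ∂P := by
    have iW : Integrable (fun ω => u (X ω) + v (Y ω)) P := iuX.add ivY
    rw [iW.integral_eq_integral_meas_lt (by filter_upwards [hW] with ω hω; simp [hω]),
      setIntegral_Ioi_comp_add _ k]
    refine setIntegral_congr_fun measurableSet_Ioi fun s hs => ?_
    refine congrArg ENNReal.toReal (measure_congr ?_)
    filter_upwards [hW] with ω hω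
    refine propext ?_
    change c (X ω) (Y ω) > s + k ↔ s < u (X ω) + v (Y ω)
    rw [hω, hposiff hs]
  have hright : ∫ ω, max (u (X' ω) + v (Y' ω)) 0 ∂P ≤
      ∫ x in Ioi k, (P {ω | c (X' ω) (Y' ω) > x}).toReal := by
    have ipos : Integrable (fun ω => max (u (X' ω) + v (Y' ω)) 0) P := (iuX'.add ivY').pos_part
    rw [ipos.integral_eq_integral_meas_lt (ae_of_all _ fun ω => le_max_right _ _),
      setIntegral_Ioi_comp_add _ k]
    have hsub : ∀ s ∈ Ioi (0 : ℝ), P.real {ω | s < max (u (X' ω) + v (Y' ω)) 0} ≤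
        (P {ω | c (X' ω) (Y' ω) > s + k}).toReal := fun s hs => by
      refine ENNReal.toReal_mono (measure_ne_top _ _) (measure_mono fun ω hω => ?_)
      refine (hposiff hs).1 (lt_of_lt_of_le hω ?_)
      exact max_le (hle _ _) (le_max_right _ _)
    have hI' : IntegrableOn (fun s => (P {ω | c (X' ω) (Y' ω) > s + k}).toReal) (Ioi 0) :=
      integrableOn_Ioi_of_antitone (K := K - k)
        (fun a b hab => antitone_measure_gt P _ (add_le_add_left hab k))
        (fun x hx => by
          have : {ω | c (X' ω) (Y' ω) > x + k} = ∅ := by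
            ext ω
            have := (abs_le.1 (hK (X' ω) (Y' ω))).2
            simp only [gt_iff_lt, mem_ofPred_eq, mem_empty_iff_false, iff_false, not_lt]
            linarith
          simp [this]) 0
    refine setIntegral_mono_on (Integrable.mono' hI' ?_ ?_) hI' measurableSet_Ioi hsub
    · exact (antitone_measure_gt P
        fun ω => max (u (X' ω) + v (Y' ω)) 0).measurable.aestronglyMeasurable
    · refine (ae_restrict_iff' measurableSet_Ioi).2 (ae_of_all _ fun s hs => ?_)
      rw [Real.norm_of_nonneg measureReal_nonneg]
      exact hsub s hs
  rw [hleft, hev]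
  exact (integral_mono (iuX'.add ivY') (iuX'.add ivY').pos_part fun ω => le_max_left _ _).trans
    hright

theorem exists_supergradient {f : ℝ → ℝ} {n : ℝ} (hconc : ConcaveOn ℝ (Icc 0 1) f)
    (hmono : MonotoneOn f (Icc 0 1)) (h0 : f 0 = 0) (hn : 0 ≤ n)
    (hle : ∀ u ∈ Icc (0 : ℝ) 1, f u ≤ n * u) {u : ℝ} (hu : u ∈ Icc (0 : ℝ) 1) :
    ∃ a ∈ Icc 0 n, ∀ v ∈ Icc (0 : ℝ) 1, f v ≤ f u + a * (v - u) := by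
  rcases hu.1.eq_or_lt with rfl | hu0
  · exact ⟨n, ⟨hn, le_rfl⟩, fun v hv => by simpa [h0] using hle v hv⟩
  set A : Set ℝ := (fun v => (f u - f v) / (u - v)) '' Ico 0 u with hA
  have hAn : A.Nonempty := ⟨_, 0, ⟨le_rfl, hu0⟩, rfl⟩
  have hmem : ∀ v ∈ Ico 0 u, v ∈ Icc (0 : ℝ) 1 := fun v hv => ⟨hv.1, hv.2.le.trans hu.2⟩
  have hA0 : ∀ a ∈ A, 0 ≤ a := by
    rintro _ ⟨v, hv, rfl⟩
    exact div_nonneg (sub_nonneg.2 (hmono (hmem v hv) hu hv.2.le)) (sub_nonneg.2 hv.2.le)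
  have hAb : BddBelow A := ⟨0, hA0⟩
  refine ⟨sInf A, ⟨le_csInf hAn hA0, ?_⟩, fun v hv => ?_⟩
  · refine (csInf_le hAb ⟨0, ⟨le_rfl, hu0⟩, rfl⟩).trans ?_
    simp only [h0, sub_zero]
    exact (div_le_iff₀ hu0).2 (hle u hu)
  · rcases lt_trichotomy v u with h | rfl | h
    · have := csInf_le hAb ⟨v, ⟨hv.1, h⟩, rfl⟩
      rw [le_div_iff₀ (sub_pos.2 h)] at this
      linarith
    · simp
    · have : (f v - f u) / (v - u) ≤ sInf A := by
        refine le_csInf hAn ?_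
        rintro _ ⟨w, hw, rfl⟩
        exact hconc.slope_anti_adjacent (hmem w hw) hv hw.2 h
      rw [div_le_iff₀ (sub_pos.2 h)] at this
      linarith

theorem setIntegral_nonneg_of_isUpperSet {D : ℝ → ℝ} {K : ℝ} (hK : ∀ x, x < K → D x = 0)
    (htail : ∀ k, 0 ≤ ∫ x in Ioi k, D x) {A : Set ℝ} (hA : IsUpperSet A) :
    0 ≤ ∫ x in A, D x := by
  by_cases hb : BddBelow A
  · rcases A.eq_empty_or_nonempty with rfl | hne
    · simp
    have h1 : Ioi (sInf A) ⊆ A := fun x hx => by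
      obtain ⟨a, ha, hax⟩ := (csInf_lt_iff hb hne).1 hx
      exact hA hax.le ha
    have h2 : A ⊆ Ici (sInf A) := fun x hx => csInf_le hb hx
    have h3 : A =ᵐ[volume] Ioi (sInf A) :=
      (h2.eventuallyLE.trans Ioi_ae_eq_Ici.symm.le).antisymm h1.eventuallyLE
    rw [setIntegral_congr_set h3]
    exact htail _
  · have hAu : A = univ := eq_univ_of_forall fun x => by
      obtain ⟨a, ha, hax⟩ := not_bddBelow_iff.1 hb x
      exact hA hax.le ha
    have := htail (K - 1)
    rwa [setIntegral_eq_integral_of_forall_compl_eq_zero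
      (fun x hx => hK x (by simp only [mem_Ioi, not_lt] at hx; linarith)),
      ← setIntegral_univ, ← hAu] at this

theorem integral_mul_nonneg_of_tails_nonneg {G D : ℝ → ℝ} {n K : ℝ} (hG : Monotone G)
    (hGn : ∀ x, G x ∈ Icc 0 n) (hD : Integrable D) (hK : ∀ x, x < K → D x = 0)
    (htail : ∀ k, 0 ≤ ∫ x in Ioi k, D x) : 0 ≤ ∫ x, G x * D x := by
  have key : ∀ x, G x * D x =
      ∫ t in Ioc 0 n, {p : ℝ × ℝ | p.2 < G p.1}.indicator (fun p => D p.1) (x, t) := fun x => by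
    have : (fun t => {p : ℝ × ℝ | p.2 < G p.1}.indicator (fun p => D p.1) (x, t)) =
        (Iio (G x)).indicator fun _ => D x := by
      ext t
      simp [indicator]
    rw [this, setIntegral_indicator measurableSet_Iio]
    have hs : Ioc 0 n ∩ Iio (G x) = Ioo 0 (G x) := by
      ext t
      have := (hGn x).2
      simp only [mem_inter_iff, mem_Ioc, mem_Iio, mem_Ioo]
      exact ⟨fun h => ⟨h.1.1, h.2⟩, fun h => ⟨⟨h.1, h.2.le.trans this⟩, h.2⟩⟩
    rw [hs]
    simp [(hGn x).1]
  have hint : Integrable ({p : ℝ × ℝ | p.2 < G p.1}.indicator fun p => D p.1)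
      (volume.prod (volume.restrict (Ioc 0 n))) := by
    refine Integrable.indicator (hD.comp_fst _) ?_
    exact measurableSet_lt measurable_snd (hG.measurable.comp measurable_fst)
  simp_rw [key]
  rw [integral_integral_swap
    (f := fun x t => {p : ℝ × ℝ | p.2 < G p.1}.indicator (fun p => D p.1) (x, t)) hint]
  refine integral_nonneg fun t => ?_
  have : (fun x => {p : ℝ × ℝ | p.2 < G p.1}.indicator (fun p => D p.1) (x, t)) =
      {x | t < G x}.indicator D := by
    ext x
    simp [indicator]
  simp only [Pi.zero_apply, this]
  rw [integral_indicator (measurableSet_lt measurable_const hG.measurable)]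
  exact setIntegral_nonneg_of_isUpperSet hK htail fun a b hab ha => lt_of_lt_of_le ha (hG hab)

theorem IsDistortion.mem_Icc {h : ℝ → ℝ} (hdist : IsDistortion h) :
    ∀ u ∈ Icc (0 : ℝ) 1, h u ∈ Icc (0 : ℝ) 1 := fun _ hu =>
  ⟨hdist.2.1 ▸ hdist.1 ⟨le_rfl, zero_le_one⟩ hu hu.1,
    hdist.2.2 ▸ hdist.1 hu ⟨zero_le_one, le_rfl⟩ hu.2⟩

/-- Survival function of a random variable with values in `[-K, K]`. -/
structure IsSurvival (S : ℝ → ℝ) (K : ℝ) : Prop where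
  antitone : Antitone S
  mem_Icc : ∀ x, S x ∈ Icc (0 : ℝ) 1
  eq_one : ∀ x, x < -K → S x = 1
  eq_zero : ∀ x, K ≤ x → S x = 0

namespace IsSurvival

variable {S S' : ℝ → ℝ} {K : ℝ}

theorem measurable_comp (hS : IsSurvival S K) {h : ℝ → ℝ} (hmono : MonotoneOn h (Icc 0 1)) :
    Measurable fun x => h (S x) :=
  Antitone.measurable fun _ _ hab => hmono (hS.mem_Icc _) (hS.mem_Icc _) (hS.antitone hab)

theorem sub_eq_zero (hS : IsSurvival S K) (hS' : IsSurvival S' K) (h : ℝ → ℝ) {x : ℝ}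
    (hx : x ∉ Icc (-K) K) : h (S' x) - h (S x) = 0 := by
  rcases lt_or_ge x (-K) with h1 | h1
  · rw [hS.eq_one x h1, hS'.eq_one x h1, sub_self]
  · have h2 : K ≤ x := by
      by_contra h2
      exact hx ⟨h1, (not_le.1 h2).le⟩
    rw [hS.eq_zero x h2, hS'.eq_zero x h2, sub_self]

theorem abs_sub_le (hS : IsSurvival S K) (hS' : IsSurvival S' K) {h : ℝ → ℝ}
    (hb : ∀ u ∈ Icc (0 : ℝ) 1, h u ∈ Icc (0 : ℝ) 1) (x : ℝ) :
    |h (S' x) - h (S x)| ≤ (Icc (-K) K).indicator (fun _ => 1) x := by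
  by_cases hx : x ∈ Icc (-K) K
  · have h1 := hb _ (hS.mem_Icc x)
    have h2 := hb _ (hS'.mem_Icc x)
    rw [indicator_of_mem hx, abs_le]
    constructor <;> linarith [h1.1, h1.2, h2.1, h2.2]
  · rw [hS.sub_eq_zero hS' h hx, indicator_of_notMem hx, abs_zero]

theorem integrable_indicator_one (K : ℝ) :
    Integrable ((Icc (-K) K).indicator fun _ => (1 : ℝ)) :=
  (integrable_indicator_iff measurableSet_Icc).2 (by simp)

theorem integrable_sub (hS : IsSurvival S K) (hS' : IsSurvival S' K) {h : ℝ → ℝ}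
    (hmono : MonotoneOn h (Icc 0 1)) (hb : ∀ u ∈ Icc (0 : ℝ) 1, h u ∈ Icc (0 : ℝ) 1) :
    Integrable fun x => h (S' x) - h (S x) :=
  (integrable_indicator_one K).mono'
    ((hS'.measurable_comp hmono).sub (hS.measurable_comp hmono)).aestronglyMeasurable
    (ae_of_all _ fun x => hS.abs_sub_le hS' hb x)

theorem integral_sub_nonneg_of_le_mul (hS : IsSurvival S K) (hS' : IsSurvival S' K)
    (htail : ∀ k, ∫ x in Ioi k, S x ≤ ∫ x in Ioi k, S' x) {f : ℝ → ℝ} {n : ℝ}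
    (hconc : ConcaveOn ℝ (Icc 0 1) f) (hmono : MonotoneOn f (Icc 0 1)) (h0 : f 0 = 0)
    (hb : ∀ u ∈ Icc (0 : ℝ) 1, f u ∈ Icc (0 : ℝ) 1) (hn : 0 ≤ n)
    (hle : ∀ u ∈ Icc (0 : ℝ) 1, f u ≤ n * u) : 0 ≤ ∫ x, (f (S' x) - f (S x)) := by
  choose! g hg hsg using fun u (hu : u ∈ Icc (0 : ℝ) 1) =>
    exists_supergradient hconc hmono h0 hn hle hu
  have hganti : ∀ u ∈ Icc (0 : ℝ) 1, ∀ w ∈ Icc (0 : ℝ) 1, u ≤ w → g w ≤ g u := by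
    intro u hu w hw huw
    rcases huw.eq_or_lt with rfl | huw
    · exact le_rfl
    have h1 := hsg u hu w hw
    have h2 := hsg w hw u hu
    by_contra! hlt
    nlinarith [mul_pos (sub_pos.2 hlt) (sub_pos.2 huw)]
  have hG : Monotone fun x => g (S' x) := fun a b hab =>
    hganti _ (hS'.mem_Icc b) _ (hS'.mem_Icc a) (hS'.antitone hab)
  have hDint : Integrable fun x => S' x - S x :=
    hS.integrable_sub hS' (h := id) monotoneOn_id fun u hu => hu
  have hGD := integral_mul_nonneg_of_tails_nonneg (D := fun x => S' x - S x) (K := -K) hG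
    (fun x => hg _ (hS'.mem_Icc x)) hDint
    (fun x hx => hS.sub_eq_zero hS' id fun hx' => absurd hx'.1 (not_le.2 hx))
    (fun k => by
      rw [integral_sub (integrableOn_Ioi_of_antitone hS'.antitone hS'.eq_zero k)
        (integrableOn_Ioi_of_antitone hS.antitone hS.eq_zero k)]
      exact sub_nonneg.2 (htail k))
  refine hGD.trans (integral_mono ?_ (hS.integrable_sub hS' hmono hb) fun x => ?_)
  · refine hDint.bdd_mul (c := n) hG.measurable.aestronglyMeasurable (ae_of_all _ fun x => ?_)
    have := hg _ (hS'.mem_Icc x)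
    rw [Real.norm_of_nonneg this.1]
    exact this.2
  · have := hsg _ (hS'.mem_Icc x) _ (hS.mem_Icc x)
    dsimp only
    linarith

theorem integral_sub_nonneg (hS : IsSurvival S K) (hS' : IsSurvival S' K)
    (htail : ∀ k, ∫ x in Ioi k, S x ≤ ∫ x in Ioi k, S' x) {h : ℝ → ℝ}
    (hdist : IsDistortion h) (hconc : ConcaveOn ℝ (Icc 0 1) h) :
    0 ≤ ∫ x, (h (S' x) - h (S x)) := by
  have hb := hdist.mem_Icc
  obtain ⟨hmono, h0, -⟩ := hdist
  let f : ℕ → ℝ → ℝ := fun n u => min (h u) (n * u)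
  have hfmono : ∀ n, MonotoneOn (f n) (Icc 0 1) := fun n u hu w hw huw =>
    min_le_min (hmono hu hw huw) (mul_le_mul_of_nonneg_left huw n.cast_nonneg)
  have hfb : ∀ n, ∀ u ∈ Icc (0 : ℝ) 1, f n u ∈ Icc (0 : ℝ) 1 := fun n u hu =>
    ⟨le_min (hb u hu).1 (mul_nonneg n.cast_nonneg hu.1), (min_le_left _ _).trans (hb u hu).2⟩
  have hlim : ∀ u ∈ Icc (0 : ℝ) 1,
      Filter.Tendsto (fun n => f n u) Filter.atTop (nhds (h u)) := fun u hu => by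
    rcases hu.1.eq_or_lt with rfl | hu0
    · simp [f, h0]
    refine tendsto_const_nhds.congr' ?_
    obtain ⟨N, hN⟩ := exists_nat_ge (1 / u)
    filter_upwards [Filter.eventually_ge_atTop N] with n hn
    refine (min_eq_left ((hb u hu).2.trans ?_)).symm
    rw [div_le_iff₀ hu0] at hN
    exact hN.trans (mul_le_mul_of_nonneg_right (Nat.cast_le.2 hn) hu0.le)
  refine ge_of_tendsto' (tendsto_integral_of_dominated_convergence
    ((Icc (-K) K).indicator fun _ => 1) (F := fun n x => f n (S' x) - f n (S x))
    (fun n => (hS.integrable_sub hS' (hfmono n) (hfb n)).aestronglyMeasurable)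
    (integrable_indicator_one K) (fun n => ae_of_all _ (hS.abs_sub_le hS' (hfb n)))
    (ae_of_all _ fun x => (hlim _ (hS'.mem_Icc x)).sub (hlim _ (hS.mem_Icc x)))) fun n => ?_
  refine hS.integral_sub_nonneg_of_le_mul hS' htail (n := n) ?_ (hfmono n) (by simp [f, h0])
    (hfb n) n.cast_nonneg fun u _ => min_le_right _ _
  refine hconc.inf ⟨convex_Icc 0 1, fun x _ y _ a b _ _ _ => le_of_eq ?_⟩
  simp only [smul_eq_mul]
  ring

theorem integrableOn_Ioi_comp (hS : IsSurvival S K) {h : ℝ → ℝ} (hdist : IsDistortion h) :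
    IntegrableOn (fun x => h (S x)) (Ioi 0) :=
  integrableOn_Ioi_of_antitone (K := K)
    (fun _ _ hab => hdist.1 (hS.mem_Icc _) (hS.mem_Icc _) (hS.antitone hab))
    (fun x hx => by rw [hS.eq_zero x hx, hdist.2.1]) 0

theorem integrableOn_Iio_comp (hS : IsSurvival S K) {h : ℝ → ℝ} (hdist : IsDistortion h) :
    IntegrableOn (fun x => h (S x) - 1) (Iio 0) := by
  have h1 : IntegrableOn (fun x => 1 - h (S (-x))) (Ioi 0) :=
    integrableOn_Ioi_of_antitone (K := K + 1)
      (fun a b hab => sub_le_sub_left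
        (hdist.1 (hS.mem_Icc _) (hS.mem_Icc _) (hS.antitone (neg_le_neg hab))) 1)
      (fun x hx => by rw [hS.eq_one (-x) (by linarith), hdist.2.2, sub_self]) 0
  have h2 : IntegrableOn (fun x => 1 - h (S x)) (Iio 0) := by
    simpa using h1.comp_neg
  simpa [Pi.neg_def] using h2.neg

end IsSurvival

theorem distExp_le_of_stopLoss_le (P : Measure Ω) [IsProbabilityMeasure P] {h : ℝ → ℝ}
    (hdist : IsDistortion h) (hconc : ConcaveOn ℝ (Icc 0 1) h) {Z Z' : Ω → ℝ} {K : ℝ}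
    (hZ : ∀ ω, |Z ω| ≤ K) (hZ' : ∀ ω, |Z' ω| ≤ K)
    (htail : ∀ k, ∫ x in Ioi k, (P {ω | Z ω > x}).toReal ≤
      ∫ x in Ioi k, (P {ω | Z' ω > x}).toReal) : distExp P h Z ≤ distExp P h Z' := by
  have hsurv : ∀ {W : Ω → ℝ}, (∀ ω, |W ω| ≤ K) →
      IsSurvival (fun x => (P {ω | W ω > x}).toReal) K := fun {W} hW =>
    { antitone := antitone_measure_gt P W
      mem_Icc := fun x => ⟨ENNReal.toReal_nonneg, by
        simpa using ENNReal.toReal_mono ENNReal.one_ne_top (prob_le_one (μ := P))⟩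
      eq_one := fun x hx => by
        have : {ω | W ω > x} = univ :=
          eq_univ_of_forall fun ω => lt_of_lt_of_le hx (abs_le.1 (hW ω)).1
        simp [this]
      eq_zero := fun x hx => by
        have : {ω | W ω > x} = ∅ :=
          eq_empty_of_forall_notMem fun ω hω => absurd ((abs_le.1 (hW ω)).2.trans hx) (not_le.2 hω)
        simp [this] }
  have hS := hsurv hZ
  have hS' := hsurv hZ'
  have hnonneg := hS.integral_sub_nonneg hS' htail hdist hconc
  have hint := hS.integrable_sub hS' hdist.1 hdist.mem_Icc
  rw [← intervalIntegral.integral_Iio_add_Ici (b := 0) hint.integrableOn hint.integrableOn,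
    integral_Ici_eq_integral_Ioi,
    integral_sub (hS'.integrableOn_Ioi_comp hdist) (hS.integrableOn_Ioi_comp hdist)] at hnonneg
  have hIio := integral_sub (hS'.integrableOn_Iio_comp hdist) (hS.integrableOn_Iio_comp hdist)
  simp only [sub_sub_sub_cancel_right] at hIio
  rw [hIio] at hnonneg
  unfold distExp
  linarith

theorem CounterMonotone.neg {P : Measure Ω} {X Y : Ω → ℝ} (hXY : CounterMonotone P X Y) :
    CounterMonotone P (fun ω => -X ω) (fun ω => -Y ω) := by
  obtain ⟨f, g, hf, hg, hfg⟩ := hXY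
  refine ⟨fun t => -f (-t), fun t => -g (-t), fun a b hab => neg_le_neg (hf (neg_le_neg hab)),
    fun a b hab => neg_le_neg (hg (neg_le_neg hab)), ?_⟩
  filter_upwards [hfg] with ω hω
  have : -(-X ω + - -Y ω) = X ω + -Y ω := by ring
  rw [this, ← hω.1, ← hω.2]
  exact ⟨rfl, rfl⟩

theorem distExp_le_of_counterMonotone_of_monotone (P : Measure Ω) [IsProbabilityMeasure P]
    {h : ℝ → ℝ} (hdist : IsDistortion h) (hconc : ConcaveOn ℝ (Icc 0 1) h)
    {c : ℝ → ℝ → ℝ} (hsup : Supermodular c) (hmono : Monotone fun q : ℝ × ℝ => c q.1 q.2)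
    {X Y X' Y' : Ω → ℝ} {M : ℝ} (hX : ∀ ω, |X ω| ≤ M) (hY : ∀ ω, |Y ω| ≤ M)
    (hX' : ∀ ω, |X' ω| ≤ M) (hY' : ∀ ω, |Y' ω| ≤ M) (hctm : CounterMonotone P X Y)
    (hXX' : IdentDistrib X X' P P) (hYY' : IdentDistrib Y Y' P P) :
    distExp P h (fun ω => c (X ω) (Y ω)) ≤ distExp P h (fun ω => c (X' ω) (Y' ω)) := by
  let a : ℝ → ℝ := fun x => max (-M) (min x M)
  have ha : Monotone a := fun x y hxy => max_le_max le_rfl (min_le_min hxy le_rfl)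
  have haeq : ∀ {x}, |x| ≤ M → a x = x := fun hx => by
    obtain ⟨h1, h2⟩ := abs_le.1 hx
    simp [a, h1, h2]
  have hamem : ∀ x, -|M| ≤ a x ∧ a x ≤ |M| := fun x =>
    ⟨(neg_le_neg (le_abs_self M)).trans (le_max_left _ _),
      max_le (neg_le_abs M) ((min_le_right _ _).trans (le_abs_self M))⟩
  have hbdd : ∀ x y, |c (a x) (a y)| ≤ max (c |M| |M|) (-c (-|M|) (-|M|)) := fun x y => by
    have h1 : c (a x) (a y) ≤ c |M| |M| := hmono (Prod.mk_le_mk.2 ⟨(hamem x).2, (hamem y).2⟩)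
    have h2 : c (-|M|) (-|M|) ≤ c (a x) (a y) :=
      hmono (Prod.mk_le_mk.2 ⟨(hamem x).1, (hamem y).1⟩)
    exact abs_le.2 ⟨by linarith [le_max_right (c |M| |M|) (-c (-|M|) (-|M|))], h1.trans (le_max_left _ _)⟩
  have hmono' : Monotone fun q : ℝ × ℝ => c (a q.1) (a q.2) := fun p q hpq =>
    hmono (Prod.mk_le_mk.2 ⟨ha hpq.1, ha hpq.2⟩)
  have := distExp_le_of_stopLoss_le P hdist hconc (fun ω => hbdd (X ω) (Y ω))
    (fun ω => hbdd (X' ω) (Y' ω))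
    (stopLoss_le_of_counterMonotone P (hsup.comp_monotone ha) hmono' hbdd hctm hXX' hYY')
  simpa only [haeq (hX _), haeq (hY _), haeq (hX' _), haeq (hY' _)] using this

/-- For a concave distortion function h and a monotone supermodular cost c,
the counter-monotonic coupling is universally optimal for (c, h). -/
theorem countermonotonic_univOptimal_of_concave_supermodular
    (P : Measure Ω) [IsProbabilityMeasure P] (hP : AtomlessProb P)
    (h : ℝ → ℝ) (hdist : IsDistortion h) (hconc : ConcaveOn ℝ (Icc 0 1) h)
    (c : ℝ → ℝ → ℝ) (hsup : Supermodular c) (hmono : MonotoneCost c)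
    (X Y X' Y' : Ω → ℝ)
    (hX : IsBddRV X) (hY : IsBddRV Y) (hX' : IsBddRV X') (hY' : IsBddRV Y')
    (hctm : CounterMonotone P X Y)
    (hXX' : IdentDistrib X X' P P) (hYY' : IdentDistrib Y Y' P P) :
    distExp P h (fun ω => c (X ω) (Y ω)) ≤ distExp P h (fun ω => c (X' ω) (Y' ω)) := by
  obtain ⟨-, M₁, hM₁⟩ := hX
  obtain ⟨-, M₂, hM₂⟩ := hY
  obtain ⟨-, M₃, hM₃⟩ := hX'
  obtain ⟨-, M₄, hM₄⟩ := hY'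
  obtain ⟨M, h₁, h₂, h₃, h₄⟩ : ∃ M, M₁ ≤ M ∧ M₂ ≤ M ∧ M₃ ≤ M ∧ M₄ ≤ M :=
    ⟨max (max M₁ M₂) (max M₃ M₄), by simp⟩
  replace hM₁ := fun ω => (hM₁ ω).trans h₁
  replace hM₂ := fun ω => (hM₂ ω).trans h₂
  replace hM₃ := fun ω => (hM₃ ω).trans h₃
  replace hM₄ := fun ω => (hM₄ ω).trans h₄
  rcases hmono with hmono | hanti
  · exact distExp_le_of_counterMonotone_of_monotone P hdist hconc hsup hmono hM₁ hM₂ hM₃ hM₄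
      hctm hXX' hYY'
  · have := distExp_le_of_counterMonotone_of_monotone P hdist hconc
      (hsup.comp_antitone (a := fun x => -x) fun _ _ hab => neg_le_neg hab)
      (fun p q hpq => hanti (Prod.mk_le_mk.2 ⟨neg_le_neg hpq.1, neg_le_neg hpq.2⟩))
      (M := M) (fun ω => by simpa using hM₁ ω) (fun ω => by simpa using hM₂ ω)
      (fun ω => by simpa using hM₃ ω) (fun ω => by simpa using hM₄ ω) hctm.neg
      (hXX'.comp measurable_neg) (hYY'.comp measurable_neg)
    simpa using this
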